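/- Let $n \ge 1$, $s \in (0, 1/2)$, and let $K$ be a nonnegative measurable kernel with $K(x,y) \le \Lambda |x-y|^{-n-2s}$ for a.e. $x,y$ and some $\Lambda > 0$. For each $k$, let $\partial E_k$ be a class A minimal surface for $\mathrm{Per}_K$ (i.e. $\mathrm{Per}_K(E_k; \Omega) \le \mathrm{Per}_K(F; \Omega)$ for every bounded open $\Omega$ and every $F$ with $F \setminus \Omega = E_k \setminus \Omega$), and suppose $\chi_{E_k} \to \chi_E$ in $L^1_{loc}(\mathbb{R}^n)$ with $\mathrm{Per}_K(E; \Omega) < +\infty$ for every bounded open $\Omega$. Then $\partial E$ is a class A minimal surface for $\mathrm{Per}_K$. -/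

import Mathlib

open MeasureTheory Metric Set Filter
open scoped ENNReal symmDiff

/-- The nonlocal interaction `L_K(A,B) = ∫_A ∫_B K`. -/
noncomputable def interKer {n : ℕ}
    (K : EuclideanSpace ℝ (Fin n) → EuclideanSpace ℝ (Fin n) → ℝ)
    (A B : Set (EuclideanSpace ℝ (Fin n))) : ℝ≥0∞ :=
  ∫⁻ x in A, ∫⁻ y in B, ENNReal.ofReal (K x y)

/-- The nonlocal `K`-perimeter of `E` in `Ω`. -/
noncomputable def perK {n : ℕ}
    (K : EuclideanSpace ℝ (Fin n) → EuclideanSpace ℝ (Fin n) → ℝ)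
    (E Ω : Set (EuclideanSpace ℝ (Fin n))) : ℝ≥0∞ :=
  interKer K (E ∩ Ω) (Ω \ E) + interKer K (E ∩ Ω) ((E ∪ Ω)ᶜ) + interKer K (E \ Ω) (Ω \ E)

/-- A set `E` is a class A minimal surface for `Per_K` if it minimizes `Per_K(·;Ω)`
in every bounded open set `Ω` among competitors coinciding with `E` outside `Ω`. -/
def IsClassAMinimal {n : ℕ}
    (K : EuclideanSpace ℝ (Fin n) → EuclideanSpace ℝ (Fin n) → ℝ)
    (E : Set (EuclideanSpace ℝ (Fin n))) : Prop :=
  ∀ Ω : Set (EuclideanSpace ℝ (Fin n)), IsOpen Ω → Bornology.IsBounded Ω →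
    ∀ F : Set (EuclideanSpace ℝ (Fin n)), MeasurableSet F → F \ Ω = E \ Ω →
      perK K E Ω ≤ perK K F Ω

section Aux

variable {n : ℕ}

/-- Integrability and value of the tail integral of `‖z‖ ^ (-(n+2s))`. -/
lemma tail_bound (hn : 1 ≤ n) {s : ℝ} (hs : 0 < s) : ∃ C : ℝ, 0 ≤ C ∧ ∀ d : ℝ, 0 < d →
    ∫⁻ z : EuclideanSpace ℝ (Fin n) in {z | d ≤ ‖z‖}, ENNReal.ofReal (‖z‖ ^ (-((n:ℝ) + 2*s)))
      ≤ ENNReal.ofReal (C * d ^ (-(2*s))) := by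
  have : Nonempty (Fin n) := ⟨⟨0, hn⟩⟩
  have : Nontrivial (EuclideanSpace ℝ (Fin n)) := inferInstance
  refine ⟨n * (volume.real (ball (0 : EuclideanSpace ℝ (Fin n)) 1)) * (1 / (2*s)), by positivity, ?_⟩
  intro d hd
  set f : ℝ → ℝ := (Ici d).indicator (fun r => r ^ (-((n:ℝ) + 2*s))) with hf
  have hpt : ∀ y ∈ Ioi (0:ℝ), y ^ (Module.finrank ℝ (EuclideanSpace ℝ (Fin n)) - 1) • f y
      = (Ici d).indicator (fun r => r ^ (-1 - 2*s)) y := by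
    intro y hy
    have hy : 0 < y := hy
    by_cases h : y ∈ Ici d
    · simp only [hf, indicator_of_mem h, finrank_euclideanSpace, Fintype.card_fin, smul_eq_mul]
      rw [← Real.rpow_natCast, ← Real.rpow_add hy]
      congr 1
      rw [Nat.cast_sub hn]
      push_cast
      ring
    · simp [hf, indicator_of_notMem h]
  have hsub : Ici d ⊆ Ioi (0:ℝ) := fun y hy => lt_of_lt_of_le hd hy
  have hint1 : IntegrableOn (fun r : ℝ => r ^ (-1 - 2*s)) (Ici d) := by
    rw [integrableOn_Ici_iff_integrableOn_Ioi]
    exact integrableOn_Ioi_rpow_of_lt (by linarith) hd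
  have hint : Integrable (fun z : EuclideanSpace ℝ (Fin n) => f ‖z‖) := by
    rw [integrable_fun_norm_addHaar volume (f := f)]
    rw [integrableOn_congr_fun hpt measurableSet_Ioi]
    exact ((integrable_indicator_iff measurableSet_Ici).2 hint1).integrableOn
  have hval : ∫ z : EuclideanSpace ℝ (Fin n), f ‖z‖ =
      n * (volume.real (ball (0 : EuclideanSpace ℝ (Fin n)) 1)) * (1 / (2*s)) * d ^ (-(2*s)) := by
    rw [integral_fun_norm_addHaar volume f, setIntegral_congr_fun measurableSet_Ioi hpt,
      setIntegral_indicator measurableSet_Ici, inter_eq_self_of_subset_right hsub,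
      integral_Ici_eq_integral_Ioi, integral_Ioi_rpow_of_lt (by linarith) hd]
    simp only [finrank_euclideanSpace, Fintype.card_fin, smul_eq_mul, nsmul_eq_mul]
    rw [show -1 - 2*s + 1 = -(2*s) by ring]
    field_simp
  have hms : MeasurableSet {z : EuclideanSpace ℝ (Fin n) | d ≤ ‖z‖} :=
    measurableSet_le measurable_const measurable_norm
  have h0 : ∀ z : EuclideanSpace ℝ (Fin n), 0 ≤ f ‖z‖ := by
    intro z
    refine indicator_nonneg (fun r hr => ?_) _
    exact Real.rpow_nonneg (hd.le.trans hr) _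
  rw [← hval, ofReal_integral_eq_lintegral_ofReal hint (ae_of_all _ h0), ← lintegral_indicator hms]
  refine lintegral_mono fun z => ?_
  by_cases h : d ≤ ‖z‖
  · simp [hf, indicator, h]
  · simp [hf, indicator, h]

lemma inner_finite (hn : 1 ≤ n) {s : ℝ} (hs : s ∈ Ioo (0:ℝ) (1/2)) {R : ℝ} (hR : 0 < R) (C : ℝ) :
    ∫⁻ x : EuclideanSpace ℝ (Fin n) in ball 0 R, ENNReal.ofReal (C * (R - ‖x‖) ^ (-(2*s))) < ⊤ := by
  have : Nonempty (Fin n) := ⟨⟨0, hn⟩⟩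
  have : Nontrivial (EuclideanSpace ℝ (Fin n)) := inferInstance
  have h1 : IntegrableOn (fun y : ℝ => (R - y) ^ (-(2*s))) (Ioo 0 R) := by
    have h2 : IntervalIntegrable (fun y : ℝ => y ^ (-(2*s))) volume 0 R :=
      intervalIntegral.intervalIntegrable_rpow' (by linarith [hs.2])
    have h3 := (h2.comp_sub_left R).symm
    simp only [sub_zero, sub_self] at h3
    exact ((intervalIntegrable_iff_integrableOn_Ioo_of_le hR.le).1 h3)
  have h2 : IntegrableOn (fun y : ℝ =>
      y ^ (Module.finrank ℝ (EuclideanSpace ℝ (Fin n)) - 1) • (C * (R - y) ^ (-(2*s)))) (Ioo 0 R) := by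
    simp only [smul_eq_mul]
    refine Integrable.bdd_mul (c := R ^ (Module.finrank ℝ (EuclideanSpace ℝ (Fin n)) - 1))
      (h1.const_mul C) ?_ ?_
    · exact (measurable_id.pow_const _).aestronglyMeasurable
    · refine (ae_restrict_iff' measurableSet_Ioo).2 (ae_of_all _ fun y hy => ?_)
      rw [Real.norm_eq_abs, abs_of_nonneg (pow_nonneg hy.1.le _)]
      exact pow_le_pow_left₀ hy.1.le hy.2.le _
  have h3 := (integrableOn_fun_norm_addHaar (volume : Measure (EuclideanSpace ℝ (Fin n)))
    (f := fun y => C * (R - y) ^ (-(2*s))) (r := R)).2 h2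
  exact h3.lintegral_lt_top

lemma cross_finite (hn : 1 ≤ n) {s : ℝ} (hs : s ∈ Ioo (0:ℝ) (1/2)) {R : ℝ} (hR : 0 < R) :
    ∫⁻ p : EuclideanSpace ℝ (Fin n) × EuclideanSpace ℝ (Fin n) in ball 0 R ×ˢ (ball 0 R)ᶜ,
      ENNReal.ofReal (‖p.1 - p.2‖ ^ (-((n:ℝ) + 2*s))) < ⊤ := by
  obtain ⟨C, hC, hbd⟩ := tail_bound (n := n) hn hs.1
  rw [Measure.volume_eq_prod, setLIntegral_prod _ (by fun_prop)]
  refine lt_of_le_of_lt ?_ (inner_finite (n := n) hn hs hR C)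
  refine setLIntegral_mono' measurableSet_ball fun x hx => ?_
  have hx' : ‖x‖ < R := by simpa using hx
  refine le_trans ?_ (hbd (R - ‖x‖) (by linarith))
  have hms : MeasurableSet {z : EuclideanSpace ℝ (Fin n) | R - ‖x‖ ≤ ‖z‖} :=
    measurableSet_le measurable_const measurable_norm
  rw [← lintegral_indicator hms, ← lintegral_indicator measurableSet_ball.compl,
    ← lintegral_sub_left_eq_self
      ({z : EuclideanSpace ℝ (Fin n) | R - ‖x‖ ≤ ‖z‖}.indicator _) x]
  refine lintegral_mono fun y => ?_
  by_cases hy : y ∈ (ball (0 : EuclideanSpace ℝ (Fin n)) R)ᶜ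
  · have hy' : R ≤ ‖y‖ := by simpa using hy
    have : x - y ∈ {z : EuclideanSpace ℝ (Fin n) | R - ‖x‖ ≤ ‖z‖} := by
      have := norm_sub_norm_le y x
      rw [norm_sub_rev] at this
      simp only [mem_ofPred_eq]
      linarith
    rw [indicator_of_mem hy, indicator_of_mem this]
  · rw [indicator_of_notMem hy]
    exact zero_le

lemma cross_finite' (hn : 1 ≤ n) {s : ℝ} (hs : s ∈ Ioo (0:ℝ) (1/2)) {R : ℝ} (hR : 0 < R) :
    ∫⁻ p : EuclideanSpace ℝ (Fin n) × EuclideanSpace ℝ (Fin n) in (ball 0 R)ᶜ ×ˢ ball 0 R,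
      ENNReal.ofReal (‖p.1 - p.2‖ ^ (-((n:ℝ) + 2*s))) < ⊤ := by
  have h := cross_finite (n := n) hn hs hR
  rw [Measure.volume_eq_prod, setLIntegral_prod_symm _ (by fun_prop)]
  rw [Measure.volume_eq_prod, setLIntegral_prod _ (by fun_prop)] at h
  simpa only [norm_sub_rev] using h

/-- The interaction measure. -/
noncomputable def kerMeas (K : EuclideanSpace ℝ (Fin n) → EuclideanSpace ℝ (Fin n) → ℝ) :
    Measure (EuclideanSpace ℝ (Fin n) × EuclideanSpace ℝ (Fin n)) :=
  volume.withDensity (fun p => ENNReal.ofReal (K p.1 p.2))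

/-- The set of pairs counted by the perimeter. -/
def perSet (E Ω : Set (EuclideanSpace ℝ (Fin n))) :
    Set (EuclideanSpace ℝ (Fin n) × EuclideanSpace ℝ (Fin n)) :=
  (E ×ˢ Eᶜ) \ (Ωᶜ ×ˢ Ωᶜ)

lemma perSet_meas {E Ω : Set (EuclideanSpace ℝ (Fin n))} (hE : MeasurableSet E)
    (hΩ : MeasurableSet Ω) : MeasurableSet (perSet E Ω) :=
  (hE.prod hE.compl).diff (hΩ.compl.prod hΩ.compl)

variable {K : EuclideanSpace ℝ (Fin n) → EuclideanSpace ℝ (Fin n) → ℝ}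

lemma interKer_eq (hK : Measurable (Function.uncurry K)) (A B : Set (EuclideanSpace ℝ (Fin n))) :
    interKer K A B = kerMeas K (A ×ˢ B) := by
  have hm : Measurable (fun p : EuclideanSpace ℝ (Fin n) × EuclideanSpace ℝ (Fin n) =>
    ENNReal.ofReal (K p.1 p.2)) := hK.ennreal_ofReal
  rw [kerMeas, withDensity_apply', Measure.volume_eq_prod, setLIntegral_prod _ hm.aemeasurable]
  rfl

lemma perK_eq (hK : Measurable (Function.uncurry K)) {E Ω : Set (EuclideanSpace ℝ (Fin n))}
    (hE : MeasurableSet E) (hΩ : MeasurableSet Ω) :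
    perK K E Ω = kerMeas K (perSet E Ω) := by
  have h2 : MeasurableSet ((E ∩ Ω) ×ˢ (E ∪ Ω)ᶜ) := (hE.inter hΩ).prod (hE.union hΩ).compl
  have h3 : MeasurableSet ((E \ Ω) ×ˢ (Ω \ E)) := (hE.diff hΩ).prod (hΩ.diff hE)
  rw [perK, interKer_eq hK, interKer_eq hK, interKer_eq hK, ← measure_union _ h2,
    ← measure_union _ h3]
  · congr 1
    ext ⟨x, y⟩
    simp only [perSet, mem_union, mem_prod, mem_inter_iff, Set.mem_sdiff, mem_compl_iff]
    tauto
  · rw [Set.disjoint_left]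
    rintro ⟨x, y⟩
    simp only [mem_union, mem_prod, mem_inter_iff, Set.mem_sdiff, mem_compl_iff]
    tauto
  · rw [Set.disjoint_left]
    rintro ⟨x, y⟩
    simp only [mem_prod, mem_inter_iff, Set.mem_sdiff, mem_compl_iff, mem_union]
    tauto

lemma kerMeas_le {s Λ : ℝ} (hΛ : 0 < Λ)
    (hKupp : ∀ᵐ p : EuclideanSpace ℝ (Fin n) × EuclideanSpace ℝ (Fin n),
        K p.1 p.2 ≤ Λ * ‖p.1 - p.2‖ ^ (-((n : ℝ) + 2*s)))
    (S : Set (EuclideanSpace ℝ (Fin n) × EuclideanSpace ℝ (Fin n)))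
    (h : ∫⁻ p in S, ENNReal.ofReal (‖p.1 - p.2‖ ^ (-((n:ℝ) + 2*s))) < ⊤) :
    kerMeas K S < ⊤ := by
  rw [kerMeas, withDensity_apply']
  calc ∫⁻ p in S, ENNReal.ofReal (K p.1 p.2)
      ≤ ∫⁻ p in S, ENNReal.ofReal Λ * ENNReal.ofReal (‖p.1 - p.2‖ ^ (-((n:ℝ) + 2*s))) := by
        refine lintegral_mono_ae (ae_restrict_of_ae ?_)
        filter_upwards [hKupp] with p hp
        rw [← ENNReal.ofReal_mul hΛ.le]
        exact ENNReal.ofReal_le_ofReal hp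
    _ = ENNReal.ofReal Λ * ∫⁻ p in S, ENNReal.ofReal (‖p.1 - p.2‖ ^ (-((n:ℝ) + 2*s))) :=
        lintegral_const_mul' _ _ ENNReal.ofReal_ne_top
    _ < ⊤ := ENNReal.mul_lt_top ENNReal.ofReal_lt_top h

/-- Fatou for sets. -/
lemma measure_le_liminf {α : Type*} [MeasurableSpace α] (μ : Measure α) {A : Set α} {As : ℕ → Set α}
    (hA : MeasurableSet A) (hAs : ∀ k, MeasurableSet (As k))
    (h : ∀ᵐ x ∂μ, x ∈ A → ∀ᶠ k in atTop, x ∈ As k) :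
    μ A ≤ liminf (fun k => μ (As k)) atTop := by
  calc μ A = ∫⁻ x, A.indicator 1 x ∂μ := (lintegral_indicator_one hA).symm
    _ ≤ ∫⁻ x, liminf (fun k => (As k).indicator (1 : α → ℝ≥0∞) x) atTop ∂μ := by
        refine lintegral_mono_ae ?_
        filter_upwards [h] with x hx
        by_cases hxA : x ∈ A
        · rw [indicator_of_mem hxA]
          refine le_liminf_of_le (by isBoundedDefault) ?_
          filter_upwards [hx hxA] with k hk
          rw [indicator_of_mem hk]
        · rw [indicator_of_notMem hxA]
          exact zero_le
    _ ≤ liminf (fun k => ∫⁻ x, (As k).indicator (1 : α → ℝ≥0∞) x ∂μ) atTop :=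
        lintegral_liminf_le fun k => measurable_one.indicator (hAs k)
    _ = _ := by simp_rw [lintegral_indicator_one (hAs _)]

lemma exists_subseq {Ek : ℕ → Set (EuclideanSpace ℝ (Fin n))} {E : Set (EuclideanSpace ℝ (Fin n))}
    (hL1loc : ∀ R : ℝ, Tendsto
      (fun k => volume ((Ek k ∆ E) ∩ ball (0 : EuclideanSpace ℝ (Fin n)) R))
      atTop (nhds 0)) :
    ∃ φ : ℕ → ℕ, ∀ᵐ x : EuclideanSpace ℝ (Fin n), ∀ᶠ j in atTop, (x ∈ Ek (φ j) ↔ x ∈ E) := by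
  obtain ⟨ε, hε, hsum⟩ := ENNReal.exists_pos_sum_of_countable' (ε := 1) one_ne_zero ℕ
  have : ∀ j : ℕ, ∃ k, volume ((Ek k ∆ E) ∩ ball (0 : EuclideanSpace ℝ (Fin n)) j) < ε j :=
    fun j => ((hL1loc j).eventually_lt_const (hε j)).exists
  choose φ hφ using this
  refine ⟨φ, ?_⟩
  have hne : ∑' j, volume ((Ek (φ j) ∆ E) ∩ ball (0 : EuclideanSpace ℝ (Fin n)) j) ≠ ⊤ :=
    ((ENNReal.tsum_le_tsum fun j => (hφ j).le).trans_lt (hsum.trans ENNReal.one_lt_top)).ne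
  filter_upwards [ae_eventually_notMem hne] with x hx
  obtain ⟨N, hN⟩ := exists_nat_gt ‖x‖
  filter_upwards [hx, eventually_ge_atTop N] with j hj hjN
  have hb : x ∈ ball (0 : EuclideanSpace ℝ (Fin n)) j := by
    have : (N:ℝ) ≤ j := by exact_mod_cast hjN
    simpa using hN.trans_le this
  simp only [mem_inter_iff, hb, and_true, mem_symmDiff] at hj
  tauto

lemma comp_subset {F E B H : Set (EuclideanSpace ℝ (Fin n))}
    (h : ∀ x, x ∉ B → (x ∈ F ↔ x ∈ E)) :
    perSet ((F ∩ B) ∪ (H \ B)) B ⊆ perSet F B ∪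
      ((B ×ˢ Bᶜ) ∪ (Bᶜ ×ˢ B)) ∩ (Prod.fst ⁻¹' (H ∆ E) ∪ Prod.snd ⁻¹' (H ∆ E)) := by
  rintro ⟨x, y⟩
  have hx := h x
  have hy := h y
  simp only [perSet, Set.mem_sdiff, mem_prod, mem_compl_iff, mem_union, mem_inter_iff,
    mem_preimage, mem_symmDiff]
  clear h
  by_cases hxB : x ∈ B <;> by_cases hyB : y ∈ B <;>
    simp only [hxB, hyB, not_true_eq_false, not_false_eq_true, forall_const, true_and, and_true,
      false_and, and_false, or_false, false_or] at hx hy ⊢ <;> tauto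

lemma cut_eq {A E B Ω : Set (EuclideanSpace ℝ (Fin n))} (hΩ : Ω ⊆ B)
    (h : ∀ x, x ∉ Ω → (x ∈ A ↔ x ∈ E)) :
    perSet A B = perSet A Ω ∪ perSet E B ∩ (Ωᶜ ×ˢ Ωᶜ) := by
  ext ⟨x, y⟩
  have hx := h x
  have hy := h y
  have hx2 := @hΩ x
  have hy2 := @hΩ y
  simp only [perSet, Set.mem_sdiff, mem_prod, mem_compl_iff, mem_union, mem_inter_iff]
  clear h hΩ
  by_cases hxB : x ∈ Ω <;> by_cases hyB : y ∈ Ω <;>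
    simp only [hxB, hyB, not_true_eq_false, not_false_eq_true, forall_const, true_and, and_true,
      false_and, and_false, or_false, false_or] at hx hy hx2 hy2 ⊢ <;> tauto

end Aux

/-- `L¹_loc` limits of class A minimal surfaces for `Per_K`, with locally
finite `K`-perimeter, are class A minimal surfaces. -/
theorem statement_14 (n : ℕ) (hn : 1 ≤ n) (s Λ : ℝ) (hs : s ∈ Set.Ioo (0 : ℝ) (1/2))
    (hΛ : 0 < Λ)
    (K : EuclideanSpace ℝ (Fin n) → EuclideanSpace ℝ (Fin n) → ℝ)
    (hKmeas : Measurable (Function.uncurry K)) (hKnonneg : ∀ x y, 0 ≤ K x y)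
    (hKupp : ∀ᵐ p : EuclideanSpace ℝ (Fin n) × EuclideanSpace ℝ (Fin n),
        K p.1 p.2 ≤ Λ * ‖p.1 - p.2‖ ^ (-((n : ℝ) + 2*s)))
    (Ek : ℕ → Set (EuclideanSpace ℝ (Fin n))) (E : Set (EuclideanSpace ℝ (Fin n)))
    (hEkm : ∀ k, MeasurableSet (Ek k)) (hEm : MeasurableSet E)
    (hEkmin : ∀ k, IsClassAMinimal K (Ek k))
    (hL1loc : ∀ R : ℝ, Tendsto
      (fun k => volume ((Ek k ∆ E) ∩ ball (0 : EuclideanSpace ℝ (Fin n)) R))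
      atTop (nhds 0))
    (hEfin : ∀ Ω : Set (EuclideanSpace ℝ (Fin n)), IsOpen Ω → Bornology.IsBounded Ω →
      perK K E Ω < ⊤) :
    IsClassAMinimal K E := by
  intro Ω hΩo hΩb F hFm hFE
  obtain ⟨R, hR, hΩR⟩ : ∃ R : ℝ, 0 < R ∧ Ω ⊆ ball (0 : EuclideanSpace ℝ (Fin n)) R := by
    obtain ⟨R, h⟩ := hΩb.subset_ball_lt 0 0
    exact ⟨R, h.1, h.2⟩
  obtain ⟨φ, hφ⟩ := exists_subseq hL1loc
  set B := ball (0 : EuclideanSpace ℝ (Fin n)) R with hB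
  have hBm : MeasurableSet B := measurableSet_ball
  have hΩm : MeasurableSet Ω := hΩo.measurableSet
  set m := kerMeas K with hm
  have hFE' : ∀ x, x ∉ Ω → (x ∈ F ↔ x ∈ E) := by
    intro x hx
    have := Set.ext_iff.1 hFE x
    simp only [Set.mem_sdiff, hx, not_false_eq_true, and_true] at this
    exact this
  -- almost everywhere convergence of pairs
  have hac : m ≪ volume := withDensity_absolutelyContinuous _ _
  have hae : ∀ᵐ p ∂m, ∀ᶠ j in atTop, (p.1 ∈ Ek (φ j) ↔ p.1 ∈ E) ∧ (p.2 ∈ Ek (φ j) ↔ p.2 ∈ E) := by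
    apply hac.ae_le
    have h1 := (Measure.quasiMeasurePreserving_fst (μ := (volume : Measure (EuclideanSpace ℝ (Fin n))))
      (ν := (volume : Measure (EuclideanSpace ℝ (Fin n))))).ae hφ
    have h2 := (Measure.quasiMeasurePreserving_snd (μ := (volume : Measure (EuclideanSpace ℝ (Fin n))))
      (ν := (volume : Measure (EuclideanSpace ℝ (Fin n))))).ae hφ
    rw [Measure.volume_eq_prod]
    filter_upwards [h1, h2] with p hp1 hp2
    exact hp1.and hp2
  -- the region of cross interactions has finite measure
  set D := (B ×ˢ Bᶜ) ∪ (Bᶜ ×ˢ B) with hD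
  have hDm : MeasurableSet D := (hBm.prod hBm.compl).union (hBm.compl.prod hBm)
  have hDfin : m D < ⊤ := (measure_union_le _ _).trans_lt (ENNReal.add_lt_top.2
    ⟨kerMeas_le hΛ hKupp _ (cross_finite hn hs hR), kerMeas_le hΛ hKupp _ (cross_finite' hn hs hR)⟩)
  set T : ℕ → Set (EuclideanSpace ℝ (Fin n) × EuclideanSpace ℝ (Fin n)) := fun j =>
    D ∩ (Prod.fst ⁻¹' (Ek (φ j) ∆ E) ∪ Prod.snd ⁻¹' (Ek (φ j) ∆ E)) with hT
  have hTm : ∀ j, MeasurableSet (T j) := fun j =>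
    hDm.inter ((measurable_fst ((hEkm _).symmDiff hEm)).union
      (measurable_snd ((hEkm _).symmDiff hEm)))
  have hT0 : Tendsto (fun j => m (T j)) atTop (nhds 0) := by
    rw [← measure_empty (μ := m)]
    refine tendsto_measure_of_ae_tendsto_indicator atTop MeasurableSet.empty hTm hDm hDfin.ne
      (Eventually.of_forall fun j => inter_subset_left) ?_
    filter_upwards [hae] with p hp
    filter_upwards [hp] with j hj
    simp only [hT, mem_inter_iff, mem_union, mem_preimage, mem_symmDiff, mem_empty_iff_false]
    tauto
  -- lower semicontinuity
  have hlsc : m (perSet E B) ≤ liminf (fun j => m (perSet (Ek (φ j)) B)) atTop := by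
    refine measure_le_liminf m (perSet_meas hEm hBm) (fun j => perSet_meas (hEkm _) hBm) ?_
    filter_upwards [hae] with p hp hpE
    filter_upwards [hp] with j hj
    simp only [perSet, Set.mem_sdiff, mem_prod, mem_compl_iff] at hpE ⊢
    tauto
  -- comparison
  have hcomp : ∀ j, m (perSet (Ek (φ j)) B) ≤ m (perSet F B) + m (T j) := by
    intro j
    set G := (F ∩ B) ∪ (Ek (φ j) \ B) with hG
    have hGm : MeasurableSet G := (hFm.inter hBm).union ((hEkm _).diff hBm)
    have h1 := hEkmin (φ j) B isOpen_ball isBounded_ball G hGm (by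
      ext x
      simp only [hG, Set.mem_sdiff, mem_union, mem_inter_iff]
      tauto)
    rw [perK_eq hKmeas (hEkm _) hBm, perK_eq hKmeas hGm hBm] at h1
    refine h1.trans ((measure_mono ?_).trans (measure_union_le _ _))
    exact comp_subset (fun x hx => hFE' x fun h => hx (hΩR h))
  have hball : m (perSet E B) ≤ m (perSet F B) := by
    have ht : Tendsto (fun j => m (perSet F B) + m (T j)) atTop (nhds (m (perSet F B))) := by
      simpa using hT0.const_add (m (perSet F B))
    calc _ ≤ _ := hlsc
      _ ≤ liminf (fun j => m (perSet F B) + m (T j)) atTop :=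
          liminf_le_liminf (Eventually.of_forall hcomp)
      _ = _ := ht.liminf_eq
  -- localisation to Ω
  have hcut : ∀ A : Set (EuclideanSpace ℝ (Fin n)), MeasurableSet A → (∀ x, x ∉ Ω → (x ∈ A ↔ x ∈ E)) →
      m (perSet A B) = m (perSet A Ω) + m (perSet E B ∩ (Ωᶜ ×ˢ Ωᶜ)) := by
    intro A hA hAE
    rw [← measure_union _ ((perSet_meas hEm hBm).inter (hΩm.compl.prod hΩm.compl))]
    · congr 1
      exact cut_eq hΩR hAE
    · rw [Set.disjoint_left]
      rintro ⟨x, y⟩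
      simp only [perSet, mem_prod, mem_inter_iff, Set.mem_sdiff, mem_compl_iff]
      tauto
  have hfin : m (perSet E B ∩ (Ωᶜ ×ˢ Ωᶜ)) ≠ ⊤ := by
    have := hEfin B isOpen_ball isBounded_ball
    rw [perK_eq hKmeas hEm hBm] at this
    exact ((measure_mono inter_subset_left).trans_lt this).ne
  rw [hcut E hEm (fun _ _ => Iff.rfl), hcut F hFm hFE'] at hball
  rw [perK_eq hKmeas hEm hΩm, perK_eq hKmeas hFm hΩm]
  exact (ENNReal.add_le_add_iff_right hfin).1 hball
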